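/- arXiv:1505.06564 — 13 statements merged into one kernel-verified Lean document; each statement's English description precedes it below -/
import Mathlib

section
/- Let f : M → M' be a surjective homomorphism of modules over a commutative ring R. If N' is a classical 2-absorbing submodule of M', then the preimage f⁻¹(N') is a classical 2-absorbing submodule of M. -/
/-- A proper submodule `N` of an `R`-module `M` is *classical 2-absorbing* if whenever
`a, b, c ∈ R` and `m ∈ M` with `abc • m ∈ N`, then `ab • m ∈ N` or `ac • m ∈ N` or
`bc • m ∈ N`. -/
def IsClassical2Absorbing {R M : Type*} [CommRing R] [AddCommGroup M] [Module R M]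
    (N : Submodule R M) : Prop :=
  N ≠ ⊤ ∧ ∀ (a b c : R) (m : M), (a * b * c) • m ∈ N →
    (a * b) • m ∈ N ∨ (a * c) • m ∈ N ∨ (b * c) • m ∈ N

/-- If `f : M → M'` is a surjective `R`-linear map and `N'` is a classical 2-absorbing
submodule of `M'`, then `f⁻¹(N')` is a classical 2-absorbing submodule of `M`. -/
theorem comap_isClassical2Absorbing {R M M' : Type*} [CommRing R] [Nontrivial R]
    [AddCommGroup M] [Module R M] [AddCommGroup M'] [Module R M']
    (f : M →ₗ[R] M') (hf : Function.Surjective f)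
    (N' : Submodule R M') (hN' : IsClassical2Absorbing N') :
    IsClassical2Absorbing (N'.comap f) := by
  refine ⟨fun h => hN'.1 (Submodule.eq_top_iff'.mpr ?_), fun a b c m h => ?_⟩
  · intro y
    obtain ⟨x, rfl⟩ := hf y
    exact Submodule.eq_top_iff'.mp h x
  · simp only [Submodule.mem_comap, map_smul] at h ⊢
    exact hN'.2 a b c (f m) h
end

section
/- Let f : M → M' be a surjective homomorphism of modules over a commutative ring R. If N is a classical 2-absorbing submodule of M containing the kernel of f, then the image f(N) is a classical 2-absorbing submodule of M'. -/
/-- If `f : M → M'` is a surjective `R`-linear map and `N` is a classical 2-absorbing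
submodule of `M` containing `ker f`, then `f(N)` is a classical 2-absorbing submodule
of `M'`. -/
theorem map_isClassical2Absorbing {R M M' : Type*} [CommRing R] [Nontrivial R]
    [AddCommGroup M] [Module R M] [AddCommGroup M'] [Module R M']
    (f : M →ₗ[R] M') (hf : Function.Surjective f)
    (N : Submodule R M) (hN : IsClassical2Absorbing N) (hker : LinearMap.ker f ≤ N) :
    IsClassical2Absorbing (N.map f) := by
  have hmem : ∀ x : M, f x ∈ N.map f ↔ x ∈ N := fun x => by
    rw [← Submodule.mem_comap, Submodule.comap_map_eq_self hker]
  refine ⟨fun h => hN.1 ?_, fun a b c m hm => ?_⟩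
  · rw [← Submodule.comap_map_eq_self hker, h, Submodule.comap_top]
  · obtain ⟨x, rfl⟩ := hf m
    simp only [← map_smul, hmem] at hm ⊢
    exact hN.2 a b c x hm
end

section
/- Let M be a module over a commutative ring R and let L ⊆ N be submodules of M. Then N is a classical 2-absorbing submodule of M if and only if the quotient N/L is a classical 2-absorbing submodule of M/L. -/
/-- The classical 2-absorbing property is preserved and reflected by preimages under surjective
linear maps. -/
theorem isClassical2Absorbing_comap_iff {R M M' : Type*} [CommRing R]
    [AddCommGroup M] [Module R M] [AddCommGroup M'] [Module R M']
    {f : M →ₗ[R] M'} (hf : Function.Surjective f) (K : Submodule R M') :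
    IsClassical2Absorbing (K.comap f) ↔ IsClassical2Absorbing K := by
  have h_top : K.comap f = ⊤ ↔ K = ⊤ := by
    rw [← (Submodule.comap_injective_of_surjective hf).eq_iff (b := ⊤), Submodule.comap_top]
  simp only [IsClassical2Absorbing, ne_eq, h_top, Submodule.mem_comap, map_smul, hf.forall]

/-- For submodules `L ≤ N` of `M`, `N` is a classical 2-absorbing submodule of `M` iff
`N/L` is a classical 2-absorbing submodule of `M/L`. -/
theorem isClassical2Absorbing_quotient_iff {R M : Type*} [CommRing R] [Nontrivial R]
    [AddCommGroup M] [Module R M] (L N : Submodule R M) (hLN : L ≤ N) :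
    IsClassical2Absorbing N ↔ IsClassical2Absorbing (N.map L.mkQ) := by
  rw [← isClassical2Absorbing_comap_iff L.mkQ_surjective, Submodule.comap_map_mkQ,
    sup_eq_right.mpr hLN]
end

section
/- Let M be a module over a commutative ring R. If N₁ and N₂ are classical prime submodules of M, then N₁ ∩ N₂ is a classical 2-absorbing submodule of M. -/
/-- A proper submodule `N` of an `R`-module `M` is *classical prime* if whenever
`a, b ∈ R` and `m ∈ M` with `ab • m ∈ N`, then `a • m ∈ N` or `b • m ∈ N`. -/
def IsClassicalPrime {R M : Type*} [CommRing R] [AddCommGroup M] [Module R M]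
    (N : Submodule R M) : Prop :=
  N ≠ ⊤ ∧ ∀ (a b : R) (m : M), (a * b) • m ∈ N → a • m ∈ N ∨ b • m ∈ N

theorem IsClassicalPrime.smul_mem_or_smul_mem_or_smul_mem {R M : Type*} [CommRing R]
    [AddCommGroup M] [Module R M] {N : Submodule R M} (h : IsClassicalPrime N)
    {a b c : R} {m : M} (hm : (a * b * c) • m ∈ N) :
    a • m ∈ N ∨ b • m ∈ N ∨ c • m ∈ N := by
  rcases h.2 _ _ _ hm with hab | hc
  · exact (h.2 _ _ _ hab).imp_right Or.inl
  · exact .inr (.inr hc)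

/-- The intersection of two classical prime submodules is a classical 2-absorbing
submodule. -/
theorem inf_classicalPrime_isClassical2Absorbing {R M : Type*} [CommRing R] [Nontrivial R]
    [AddCommGroup M] [Module R M] (N₁ N₂ : Submodule R M)
    (h₁ : IsClassicalPrime N₁) (h₂ : IsClassicalPrime N₂) :
    IsClassical2Absorbing (N₁ ⊓ N₂) := by
  refine ⟨fun h => h₁.1 (top_le_iff.mp (h ▸ inf_le_left)), fun a b c m hm => ?_⟩
  have smul_left {N : Submodule R M} (x : R) {y : R} (hy : y • m ∈ N) : (x * y) • m ∈ N := by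
    rw [mul_smul]
    exact N.smul_mem x hy
  have smul_right {N : Submodule R M} {x : R} (y : R) (hx : x • m ∈ N) : (x * y) • m ∈ N := by
    rw [mul_comm]
    exact smul_left y hx
  rcases h₁.smul_mem_or_smul_mem_or_smul_mem hm.1 with h | h | h <;>
    rcases h₂.smul_mem_or_smul_mem_or_smul_mem hm.2 with h' | h' | h'
  · exact .inl ⟨smul_right b h, smul_right b h'⟩
  · exact .inl ⟨smul_right b h, smul_left a h'⟩
  · exact .inr (.inl ⟨smul_right c h, smul_left a h'⟩)
  · exact .inl ⟨smul_left a h, smul_right b h'⟩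
  · exact .inl ⟨smul_left a h, smul_left a h'⟩
  · exact .inr (.inr ⟨smul_right c h, smul_left b h'⟩)
  · exact .inr (.inl ⟨smul_left a h, smul_right c h'⟩)
  · exact .inr (.inr ⟨smul_left b h, smul_right c h'⟩)
  · exact .inr (.inl ⟨smul_left a h, smul_left a h'⟩)
end

section
/- Let N be a proper submodule of a module M over a commutative ring R. Then N is a classical prime submodule of M if and only if N is a 2-absorbing submodule of M and (N :_R M) is a prime ideal of R. -/
/-- A proper submodule `N` of an `R`-module `M` is a *2-absorbing submodule* if whenever
`a, b ∈ R` and `m ∈ M` with `ab • m ∈ N`, then `a • m ∈ N` or `b • m ∈ N` or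
`ab ∈ (N :_R M)`. -/
def Is2AbsorbingSubmodule {R M : Type*} [CommRing R] [AddCommGroup M] [Module R M]
    (N : Submodule R M) : Prop :=
  N ≠ ⊤ ∧ ∀ (a b : R) (m : M), (a * b) • m ∈ N →
    a • m ∈ N ∨ b • m ∈ N ∨ ∀ x : M, (a * b) • x ∈ N

/-- A proper submodule `N` is classical prime iff `N` is a 2-absorbing submodule and
`(N :_R M)` is a prime ideal of `R`. -/
theorem isClassicalPrime_iff_is2Absorbing_and_colon_prime {R M : Type*} [CommRing R]
    [Nontrivial R] [AddCommGroup M] [Module R M] (N : Submodule R M) (hN : N ≠ ⊤) :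
    IsClassicalPrime N ↔ Is2AbsorbingSubmodule N ∧ (N.colon ⊤).IsPrime := by
  have mem_colon_iff (r : R) : r ∈ N.colon ⊤ ↔ ∀ x : M, r • x ∈ N := by
    simp [Submodule.mem_colon]
  constructor
  · rintro ⟨-, h⟩
    refine ⟨⟨hN, fun a b m hm => (h a b m hm).imp_right Or.inl⟩, ?_⟩
    refine Ideal.isPrime_iff.mpr ⟨fun htop => hN ?_, fun {a b} hab => ?_⟩
    · refine Submodule.eq_top_iff'.mpr fun x => ?_
      simpa using (mem_colon_iff 1).mp (htop ▸ Submodule.mem_top) x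
    · rw [mem_colon_iff] at hab
      by_contra! hcon
      simp only [mem_colon_iff, not_forall] at hcon
      obtain ⟨⟨x, hx⟩, y, hy⟩ := hcon
      have hbx : b • x ∈ N := (h a b x (hab x)).resolve_left hx
      have hay : a • y ∈ N := (h a b y (hab y)).resolve_right hy
      rcases h a b (x + y) (hab _) with ha | hb
      · rw [smul_add, N.add_mem_iff_left hay] at ha
        exact hx ha
      · rw [smul_add, N.add_mem_iff_right hbx] at hb
        exact hy hb
  · rintro ⟨⟨-, h⟩, hprime⟩
    refine ⟨hN, fun a b m hm => ?_⟩
    rcases h a b m hm with ha | hb | hab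
    · exact Or.inl ha
    · exact Or.inr hb
    · exact (hprime.mem_or_mem ((mem_colon_iff _).mpr hab)).imp
        (fun ha => (mem_colon_iff a).mp ha m) (fun hb => (mem_colon_iff b).mp hb m)
end

section
/- Let N be a proper submodule of a module M over a commutative ring R. Then N is a classical 2-absorbing submodule of M if and only if for every a,b ∈ R and m ∈ M with abm ∉ N, one has (N :_R abm) = (N :_R am) or (N :_R abm) = (N :_R bm). -/
/-- A proper submodule `N` of `M` is classical 2-absorbing iff for all `a, b ∈ R` and
`m ∈ M` with `ab • m ∉ N`, `(N :_R abm) = (N :_R am)` or `(N :_R abm) = (N :_R bm)`. -/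
theorem isClassical2Absorbing_iff_colon_eq {R M : Type*} [CommRing R] [Nontrivial R]
    [AddCommGroup M] [Module R M] (N : Submodule R M) (hN : N ≠ ⊤) :
    IsClassical2Absorbing N ↔ ∀ (a b : R) (m : M), (a * b) • m ∉ N →
      {r : R | r • ((a * b) • m) ∈ N} = {r : R | r • (a • m) ∈ N} ∨
      {r : R | r • ((a * b) • m) ∈ N} = {r : R | r • (b • m) ∈ N} := by
  have left (a b r : R) (m : M) (h : r • a • m ∈ N) : r • (a * b) • m ∈ N := by
    convert N.smul_mem b h using 1
    module
  have right (a b r : R) (m : M) (h : r • b • m ∈ N) : r • (a * b) • m ∈ N := by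
    rw [mul_comm a b]
    exact left b a r m h
  constructor
  · rintro ⟨-, h⟩ a b m hab
    have hsub : (N.comap (LinearMap.toSpanSingleton R M ((a * b) • m)) : Set R) ⊆
        N.comap (LinearMap.toSpanSingleton R M (a • m)) ∪
          N.comap (LinearMap.toSpanSingleton R M (b • m)) := by
      intro r hr
      have hr' : (a * b * r) • m ∈ N := by
        rw [mul_comm, mul_smul]
        exact hr
      rcases (h a b r m hr').resolve_left hab with hc | hc
      · exact Or.inl (by simpa [smul_smul, mul_comm] using hc)
      · exact Or.inr (by simpa [smul_smul, mul_comm] using hc)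
    exact (Ideal.subset_union.mp hsub).imp
      (fun hle => Set.Subset.antisymm hle fun r => left a b r m)
      (fun hle => Set.Subset.antisymm hle fun r => right a b r m)
  · refine fun h => ⟨hN, fun a b c m habc => or_iff_not_imp_left.mpr fun hab => ?_⟩
    have hc : c ∈ {r : R | r • ((a * b) • m) ∈ N} := by
      rwa [Set.mem_ofPred_eq, smul_smul, mul_comm]
    refine (h a b m hab).imp (fun heq => ?_) (fun heq => ?_) <;>
    · rw [heq] at hc
      rwa [mul_comm, mul_smul]
end

section
/- Let N be a proper submodule of a module M over a commutative ring R. Then N is a classical 2-absorbing submodule of M if and only if for every ideals I, J, K of R and every m ∈ M with IJKm ⊆ N, either IJm ⊆ N or IKm ⊆ N or JKm ⊆ N. -/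
/-- If every element of `I` multiplies `S` into `A` or multiplies `T` into `A`, then one of the
two alternatives holds uniformly on `I`. -/
theorem Ideal.forall_mul_mem_or_forall_mul_mem {R : Type*} [CommRing R] {A I : Ideal R}
    {S T : Set R} (h : ∀ a ∈ I, (∀ s ∈ S, a * s ∈ A) ∨ ∀ t ∈ T, a * t ∈ A) :
    (∀ a ∈ I, ∀ s ∈ S, a * s ∈ A) ∨ ∀ a ∈ I, ∀ t ∈ T, a * t ∈ A := by
  have key : (I : Set R) ⊆ A.colon S ∪ A.colon T := fun a ha => by
    simpa [Submodule.mem_colon] using h a ha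
  simpa [SetLike.le_def, Submodule.mem_colon] using Ideal.subset_union.mp key

/-- The elementwise 2-absorbing condition on an ideal `A` implies the condition for products of
ideals. -/
theorem Ideal.two_absorbing_of_forall_mul_mem {R : Type*} [CommRing R] {A : Ideal R}
    (hA : ∀ a b c : R, a * b * c ∈ A → a * b ∈ A ∨ a * c ∈ A ∨ b * c ∈ A) {I J K : Ideal R}
    (h : ∀ a ∈ I, ∀ b ∈ J, ∀ c ∈ K, a * b * c ∈ A) :
    (∀ a ∈ I, ∀ b ∈ J, a * b ∈ A) ∨ (∀ a ∈ I, ∀ c ∈ K, a * c ∈ A) ∨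
      ∀ b ∈ J, ∀ c ∈ K, b * c ∈ A := by
  have of_elements (a b : R) (hK : ∀ c ∈ K, a * b * c ∈ A) :
      a * b ∈ A ∨ (∀ c ∈ K, a * c ∈ A) ∨ ∀ c ∈ K, b * c ∈ A := by
    refine or_iff_not_imp_left.mpr fun hab => ?_
    have hu : ∀ c ∈ K, (∀ s ∈ ({a} : Set R), c * s ∈ A) ∨ ∀ t ∈ ({b} : Set R), c * t ∈ A :=
      fun c hc => by
        simpa [mul_comm c] using (hA a b c (hK c hc)).resolve_left hab
    simpa [mul_comm] using Ideal.forall_mul_mem_or_forall_mul_mem hu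
  have of_element (a : R) (hJK : ∀ b ∈ J, ∀ c ∈ K, a * b * c ∈ A) :
      (∀ b ∈ J, a * b ∈ A) ∨ (∀ c ∈ K, a * c ∈ A) ∨ ∀ b ∈ J, ∀ c ∈ K, b * c ∈ A := by
    by_cases haK : ∀ c ∈ K, a * c ∈ A
    · exact .inr (.inl haK)
    have hu : ∀ b ∈ J, (∀ s ∈ ({a} : Set R), b * s ∈ A) ∨ ∀ c ∈ (K : Set R), b * c ∈ A :=
      fun b hb => (of_elements a b (hJK b hb)).imp
        (fun hab => by simpa [mul_comm b] using hab) fun hK => hK.resolve_left haK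
    exact (Ideal.forall_mul_mem_or_forall_mul_mem hu).imp
      (fun hJ b hb => mul_comm a b ▸ hJ b hb a rfl) .inr
  by_cases hJK : ∀ b ∈ J, ∀ c ∈ K, b * c ∈ A
  · exact .inr (.inr hJK)
  have hu : ∀ a ∈ I, (∀ b ∈ (J : Set R), a * b ∈ A) ∨ ∀ c ∈ (K : Set R), a * c ∈ A :=
    fun a ha => (of_element a (h a ha)).imp_right fun hK => hK.resolve_right hJK
  exact (Ideal.forall_mul_mem_or_forall_mul_mem hu).imp_right .inl

/-- A proper submodule `N` of `M` is classical 2-absorbing iff for all ideals `I, J, K`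
of `R` and all `m ∈ M` with `IJKm ⊆ N`, either `IJm ⊆ N` or `IKm ⊆ N` or `JKm ⊆ N`. -/
theorem isClassical2Absorbing_iff_ideals {R M : Type*} [CommRing R] [Nontrivial R]
    [AddCommGroup M] [Module R M] (N : Submodule R M) (hN : N ≠ ⊤) :
    IsClassical2Absorbing N ↔ ∀ (I J K : Ideal R) (m : M),
      (∀ a ∈ I, ∀ b ∈ J, ∀ c ∈ K, (a * b * c) • m ∈ N) →
        (∀ a ∈ I, ∀ b ∈ J, (a * b) • m ∈ N) ∨
        (∀ a ∈ I, ∀ c ∈ K, (a * c) • m ∈ N) ∨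
        (∀ b ∈ J, ∀ c ∈ K, (b * c) • m ∈ N) := by
  refine ⟨fun ⟨_, h⟩ I J K m hm => ?_, fun h => ⟨hN, fun a b c m hm => ?_⟩⟩
  · exact Ideal.two_absorbing_of_forall_mul_mem
      (A := N.comap (LinearMap.toSpanSingleton R M m)) (fun a b c => h a b c m) hm
  · have hspan : ∀ x ∈ Ideal.span {a}, ∀ y ∈ Ideal.span {b}, ∀ z ∈ Ideal.span {c},
        (x * y * z) • m ∈ N := by
      intro x hx y hy z hz
      obtain ⟨r, rfl⟩ := Ideal.mem_span_singleton.mp hx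
      obtain ⟨s, rfl⟩ := Ideal.mem_span_singleton.mp hy
      obtain ⟨t, rfl⟩ := Ideal.mem_span_singleton.mp hz
      have hsmul : (a * r * (b * s) * (c * t)) • m = (r * s * t) • (a * b * c) • m := by
        rw [smul_smul]
        ring_nf
      exact hsmul ▸ N.smul_mem _ hm
    have ha := Ideal.mem_span_singleton_self a
    have hb := Ideal.mem_span_singleton_self b
    have hc := Ideal.mem_span_singleton_self c
    exact (h _ _ _ m hspan).imp (fun h' => h' a ha b hb)
      (Or.imp (fun h' => h' a ha c hc) fun h' => h' b hb c hc)
end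

section
/- Let M be a module over a commutative ring R and let {K_i | i ∈ I} be a nonempty chain (totally ordered by inclusion) of classical 2-absorbing submodules of M. Then the intersection ⋂_{i ∈ I} K_i is a classical 2-absorbing submodule of M. -/
/-- The intersection of a nonempty chain of classical 2-absorbing submodules of `M` is a
classical 2-absorbing submodule of `M`. -/
theorem iInf_chain_isClassical2Absorbing {R M ι : Type*} [CommRing R] [Nontrivial R]
    [AddCommGroup M] [Module R M] [Nonempty ι] (K : ι → Submodule R M)
    (hchain : ∀ i j, K i ≤ K j ∨ K j ≤ K i)
    (habs : ∀ i, IsClassical2Absorbing (K i)) :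
    IsClassical2Absorbing (⨅ i, K i) := by
  have hdir : Directed (· ≥ ·) K := fun i j =>
    (hchain i j).elim (fun h => ⟨i, le_rfl, h⟩) (fun h => ⟨j, h, le_rfl⟩)
  refine ⟨fun htop => ?_, fun a b c m habc => ?_⟩
  · obtain ⟨i⟩ := ‹Nonempty ι›
    exact (habs i).1 (iInf_eq_top.mp htop i)
  · by_contra! hnot
    simp only [Submodule.mem_iInf, not_forall] at hnot habc
    obtain ⟨⟨i, hi⟩, ⟨j, hj⟩, ⟨k, hk⟩⟩ := hnot
    obtain ⟨p, hpi, hpj⟩ := hdir i j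
    obtain ⟨q, hqp, hqk⟩ := hdir p k
    rcases (habs q).2 a b c m (habc q) with h | h | h
    · exact hi (hpi (hqp h))
    · exact hj (hpj (hqp h))
    · exact hk (hqk h)
end

section
/- Let M be a Noetherian module over a commutative ring R. Then the set of minimal classical 2-absorbing submodules of M is finite. -/
/-- Over every submodule `N` of a Noetherian module there are only finitely many minimal
classical 2-absorbing submodules. -/
theorem finite_minimal_isClassical2Absorbing_ge {R M : Type*} [CommRing R] [AddCommGroup M]
    [Module R M] [IsNoetherian R M] (N : Submodule R M) :
    {K : Submodule R M | Minimal (fun L ↦ IsClassical2Absorbing L ∧ N ≤ L) K}.Finite := by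
  induction N using WellFoundedGT.induction with
  | ind N ih =>
  by_cases hN : IsClassical2Absorbing N
  · refine (Set.finite_singleton N).subset fun K hK ↦ ?_
    rw [Set.mem_ofPred_eq] at hK
    exact (hK.eq_of_le ⟨hN, le_rfl⟩ hK.prop.2).symm
  by_cases hT : N = ⊤
  · refine Set.finite_empty.subset fun K hK ↦ ?_
    rw [Set.mem_ofPred_eq] at hK
    exact hK.prop.1.1 (top_le_iff.mp (hT ▸ hK.prop.2))
  have h : ∃ (a b c : R) (m : M), (a * b * c) • m ∈ N ∧
      (a * b) • m ∉ N ∧ (a * c) • m ∉ N ∧ (b * c) • m ∉ N := by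
    by_contra! h
    exact hN ⟨hT, fun a b c m hm ↦ by have := h a b c m hm; tauto⟩
  obtain ⟨a, b, c, m, hm, hab, hac, hbc⟩ := h
  have hfin : ∀ x ∉ N, {K : Submodule R M | Minimal
      (fun L ↦ IsClassical2Absorbing L ∧ N ⊔ Submodule.span R {x} ≤ L) K}.Finite := by
    intro x hx
    refine ih _ (lt_of_le_of_ne le_sup_left fun h ↦ hx ?_)
    rw [h]
    exact le_sup_right (a := N) (Submodule.mem_span_singleton_self x)
  have hmin : ∀ (x : M) (K : Submodule R M), Minimal (fun L ↦ IsClassical2Absorbing L ∧ N ≤ L) K →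
      x ∈ K → Minimal (fun L ↦ IsClassical2Absorbing L ∧ N ⊔ Submodule.span R {x} ≤ L) K := by
    intro x K hK hx
    refine ⟨⟨hK.prop.1, sup_le hK.prop.2 ((Submodule.span_singleton_le_iff_mem x K).mpr hx)⟩, ?_⟩
    exact fun L hL hLK ↦ hK.le_of_le ⟨hL.1, le_sup_left.trans hL.2⟩ hLK
  refine ((hfin _ hab).union ((hfin _ hac).union (hfin _ hbc))).subset fun K hK ↦ ?_
  rw [Set.mem_ofPred_eq] at hK
  rcases hK.prop.1.2 a b c m (hK.prop.2 hm) with h | h | h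
  · exact Or.inl (hmin _ K hK h)
  · exact Or.inr (Or.inl (hmin _ K hK h))
  · exact Or.inr (Or.inr (hmin _ K hK h))

/-- A Noetherian `R`-module `M` contains only a finite number of minimal classical
2-absorbing submodules. -/
theorem finite_minimal_isClassical2Absorbing {R M : Type*} [CommRing R] [Nontrivial R]
    [AddCommGroup M] [Module R M] [IsNoetherian R M] :
    {N : Submodule R M | IsClassical2Absorbing N ∧
      ∀ K : Submodule R M, IsClassical2Absorbing K → K ≤ N → K = N}.Finite := by
  refine (finite_minimal_isClassical2Absorbing_ge (⊥ : Submodule R M)).subset fun N hN ↦ ?_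
  exact ⟨⟨hN.1, bot_le⟩, fun K hK hKN ↦ (hN.2 K hK.1 hKN).ge⟩
end

section
/- Let R be a um-ring, M an R-module and N a proper submodule of M. Then N is a classical 2-absorbing submodule of M if and only if for every a,b,c ∈ R and every submodule L of M, abcL ⊆ N implies abL ⊆ N or acL ⊆ N or bcL ⊆ N. -/
/-- A commutative ring `R` is a *um-ring* if whenever an `R`-module is equal to a finite
union of submodules, it is equal to one of them. -/
def IsUMRing (R : Type*) [CommRing R] : Prop :=
  ∀ (M : Type*) [AddCommGroup M] [Module R M] (n : ℕ) (f : Fin n → Submodule R M),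
    (∀ m : M, ∃ i, m ∈ f i) → ∃ i, ∀ m : M, m ∈ f i

universe w

open scoped Pointwise in
/-- If finitely many submodules cover `M`, so do those among them of finite index. -/
theorem Submodule.exists_mem_finiteIndex_of_cover {R M ι : Type*} [Ring R] [AddCommGroup M]
    [Module R M] [Finite ι] {p : ι → Submodule R M} (hp : ∀ m, ∃ i, m ∈ p i) (m : M) :
    ∃ i, (p i).toAddSubgroup.FiniteIndex ∧ m ∈ p i := by
  classical
  have := Fintype.ofFinite ι
  have hcovers : ⋃ i ∈ (Finset.univ : Finset ι),
      (0 : M) +ᵥ ((p i).toAddSubgroup : Set M) = Set.univ := by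
    simpa [Set.eq_univ_iff_forall] using! hp
  have h := Set.eq_univ_iff_forall.mp
    (AddSubgroup.leftCoset_cover_filter_FiniteIndex hcovers) m
  simpa using! h

/-- The um-property passes to modules in any universe: a finite cover by submodules can be
refined to submodules of finite index, hence is pulled back from a finite quotient. -/
theorem IsUMRing.exists_eq_top_of_cover {R : Type*} {M : Type*} {ι : Type*} [CommRing R]
    [AddCommGroup M] [Module R M] [Finite ι] (hR : IsUMRing.{_, w} R) (p : ι → Submodule R M)
    (hp : ∀ m, ∃ i, m ∈ p i) : ∃ i, p i = ⊤ := by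
  let T := {i // (p i).toAddSubgroup.FiniteIndex}
  let D : Submodule R M := ⨅ i : T, p i
  have hD : D.toAddSubgroup.FiniteIndex := by
    have h : D.toAddSubgroup = ⨅ i : T, (p i).toAddSubgroup := by
      ext x
      simp [D, AddSubgroup.mem_iInf]
    rw [h]
    exact AddSubgroup.finiteIndex_iInf fun i => i.2
  have : Finite (M ⧸ D) := D.toAddSubgroup.finite_quotient_of_finiteIndex
  let e : M →ₗ[R] Shrink.{w} (M ⧸ D) :=
    (Shrink.linearEquiv.{w} R (M ⧸ D)).symm.toLinearMap ∘ₗ D.mkQ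
  have he : Function.Surjective e :=
    (Shrink.linearEquiv.{w} R (M ⧸ D)).symm.surjective.comp D.mkQ_surjective
  have hker : LinearMap.ker e = D := by simp [e, LinearEquiv.ker_comp]
  obtain ⟨n, ⟨σ⟩⟩ := Finite.exists_equiv_fin T
  obtain ⟨k, hk⟩ := hR (Shrink.{w} (M ⧸ D)) n (fun k => (p (σ.symm k)).map e) fun y => by
    obtain ⟨m, rfl⟩ := he y
    obtain ⟨i, hi, hm⟩ := Submodule.exists_mem_finiteIndex_of_cover hp m
    exact ⟨σ ⟨i, hi⟩, by
      rw [Equiv.symm_apply_apply]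
      exact Submodule.mem_map_of_mem hm⟩
  refine ⟨σ.symm k, ?_⟩
  have hle : LinearMap.ker e ≤ p (σ.symm k) := hker.trans_le (iInf_le _ _)
  rw [← Submodule.comap_map_eq_self hle, Submodule.eq_top_iff']
  exact fun m => hk (e m)

/-- Over a um-ring `R`, a proper submodule `N` of `M` is classical 2-absorbing iff for all
`a, b, c ∈ R` and every submodule `L` of `M`, `abcL ⊆ N` implies `abL ⊆ N` or `acL ⊆ N`
or `bcL ⊆ N`. -/
theorem isClassical2Absorbing_iff_submodules {R M : Type*} [CommRing R] [Nontrivial R]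
    [AddCommGroup M] [Module R M] (hR : IsUMRing R) (N : Submodule R M) (hN : N ≠ ⊤) :
    IsClassical2Absorbing N ↔ ∀ (a b c : R) (L : Submodule R M),
      (∀ m ∈ L, (a * b * c) • m ∈ N) →
        (∀ m ∈ L, (a * b) • m ∈ N) ∨ (∀ m ∈ L, (a * c) • m ∈ N) ∨
        (∀ m ∈ L, (b * c) • m ∈ N) := by
  refine ⟨fun h a b c L hL => ?_, fun h => ⟨hN, fun a b c m hm => ?_⟩⟩
  · let r : Fin 3 → R := ![a * b, a * c, b * c]
    obtain ⟨i, hi⟩ := hR.exists_eq_top_of_cover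
      (fun i => N.comap (r i • L.subtype)) fun m => by
        simpa [Fin.exists_fin_succ, r] using h.2 a b c m (hL m m.2)
    have hi' : ∀ m ∈ L, r i • m ∈ N := fun m hm =>
      (Submodule.eq_top_iff'.mp hi) ⟨m, hm⟩
    fin_cases i
    · exact .inl hi'
    · exact .inr (.inl hi')
    · exact .inr (.inr hi')
  · have hspan : ∀ r : R, (∀ x ∈ R ∙ m, r • x ∈ N) ↔ r • m ∈ N := fun r => by
      refine ⟨fun h => h m (Submodule.mem_span_singleton_self m), fun h x hx => ?_⟩
      obtain ⟨s, rfl⟩ := Submodule.mem_span_singleton.mp hx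
      rw [smul_comm]
      exact N.smul_mem s h
    simpa only [hspan] using h a b c (R ∙ m) ((hspan _).mpr hm)
end

section
/- Let R be a um-ring, M an R-module and N a proper submodule of M. Then N is a classical 2-absorbing submodule of M if and only if for every submodule L of M not contained in N, the ideal (N :_R L) is a 2-absorbing ideal of R. -/
/-- A proper ideal `I` of `R` is a *2-absorbing ideal* if whenever `a, b, c ∈ R` and
`abc ∈ I`, then `ab ∈ I` or `ac ∈ I` or `bc ∈ I`. -/
def Is2AbsorbingIdeal {R : Type*} [CommRing R] (I : Ideal R) : Prop :=
  I ≠ ⊤ ∧ ∀ a b c : R, a * b * c ∈ I → a * b ∈ I ∨ a * c ∈ I ∨ b * c ∈ I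

/-- An ideal not containing `1` such that every element or its complement to `1` lies in the
ideal is the kernel of a ring homomorphism to `ZMod 2`. -/
theorem Ideal.nonempty_ringHom_zmod_two {R : Type*} [CommRing R] (I : Ideal R)
    (h1 : (1 : R) ∉ I) (h : ∀ r, r ∉ I → 1 - r ∈ I) : Nonempty (R →+* ZMod 2) := by
  classical
  have h2 : (2 : R) ∈ I := by
    by_contra h2
    have := I.neg_mem (h 2 h2)
    norm_num at this
    exact h1 this
  refine ⟨{ toFun := fun r => if r ∈ I then 0 else 1
            map_one' := if_neg h1
            map_zero' := if_pos I.zero_mem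
            map_add' := fun r s => ?_
            map_mul' := fun r s => ?_ }⟩
  · by_cases hr : r ∈ I
    · simp [hr, I.mul_mem_right s hr]
    · by_cases hs : s ∈ I
      · simp [hs, I.mul_mem_left r hs]
      · have hrs : r * s ∉ I := fun hrs => hr <| by
          convert I.add_mem hrs (I.mul_mem_left r (h s hs)) using 1
          ring
        simp [hr, hs, hrs]
  · by_cases hr : r ∈ I
    · simp [hr, I.add_mem_iff_right hr]
    · by_cases hs : s ∈ I
      · simp [hr, hs, I.add_mem_iff_left hs]
      · have hrs : r + s ∈ I := by
          convert I.sub_mem h2 (I.add_mem (h r hr) (h s hs)) using 1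
          ring
        simp only [hr, hs, hrs, if_true, if_false]
        decide

/-- A module which is the union of two submodules is equal to one of them. -/
theorem Submodule.eq_top_or_eq_top_of_forall_mem {R M : Type*} [Ring R] [AddCommGroup M]
    [Module R M] {A B : Submodule R M} (h : ∀ m, m ∈ A ∨ m ∈ B) : A = ⊤ ∨ B = ⊤ := by
  by_contra! hne
  obtain ⟨x, hx⟩ := SetLike.exists_not_mem_of_ne_top A hne.1 rfl
  obtain ⟨y, hy⟩ := SetLike.exists_not_mem_of_ne_top B hne.2 rfl
  have hxB := (h x).resolve_left hx
  have hyA := (h y).resolve_right hy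
  rcases h (x + y) with hA | hB
  · exact hx ((A.add_mem_iff_left hyA).1 hA)
  · exact hy ((B.add_mem_iff_right hxB).1 hB)

/-- If `R` has no residue field with two elements, then an `R`-module which is the union of
three submodules is equal to one of them. -/
theorem Submodule.eq_top_of_forall_mem_three {R M : Type*} [CommRing R] [AddCommGroup M]
    [Module R M] (hR : IsEmpty (R →+* ZMod 2)) {A B C : Submodule R M}
    (h : ∀ m, m ∈ A ∨ m ∈ B ∨ m ∈ C) : A = ⊤ ∨ B = ⊤ ∨ C = ⊤ := by
  by_contra! hne
  obtain ⟨hA, hB, hC⟩ := hne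
  obtain ⟨x, hxB, hxC⟩ : ∃ x, x ∉ B ∧ x ∉ C := by
    by_contra! H
    have := Submodule.eq_top_or_eq_top_of_forall_mem (A := B) (B := C)
      fun m => or_iff_not_imp_left.2 (H m)
    tauto
  obtain ⟨y, hyA, hyC⟩ : ∃ x, x ∉ A ∧ x ∉ C := by
    by_contra! H
    have := Submodule.eq_top_or_eq_top_of_forall_mem (A := A) (B := C)
      fun m => or_iff_not_imp_left.2 (H m)
    tauto
  obtain ⟨z, hzA, hzB⟩ : ∃ x, x ∉ A ∧ x ∉ B := by
    by_contra! H
    have := Submodule.eq_top_or_eq_top_of_forall_mem (A := A) (B := B)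
      fun m => or_iff_not_imp_left.2 (H m)
    tauto
  have hxA : x ∈ A := by have := h x; tauto
  have hyB : y ∈ B := by have := h y; tauto
  have hACB : ∀ k ∈ A, k ∈ C → k ∈ B := fun k hkA hkC => by
    have hy := h (k + y)
    rw [A.add_mem_iff_right hkA, C.add_mem_iff_right hkC, B.add_mem_iff_left hyB] at hy
    tauto
  have hadd : ∀ u ∈ A, u ∉ B → u + y ∈ C := fun u huA huB => by
    have hu := h (u + y)
    rw [A.add_mem_iff_right huA, B.add_mem_iff_left hyB] at hu
    tauto
  have hsub : ∀ u ∈ A, u ∉ B → x - u ∈ B := fun u huA huB =>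
    hACB _ (A.sub_mem hxA huA) <| by
      simpa using C.sub_mem (hadd x hxA hxB) (hadd u huA huB)
  obtain ⟨φ⟩ := (B.colon {x}).nonempty_ringHom_zmod_two
    (by simpa [Submodule.mem_colon_singleton] using hxB) fun r hr => by
      rw [Submodule.mem_colon_singleton] at hr ⊢
      simpa [sub_smul] using hsub (r • x) (A.smul_mem r hxA) hr
  exact hR.false φ

/-- A um-ring has no residue field with two elements. -/
theorem IsUMRing.isEmpty_ringHom_zmod_two.{u, v} {R : Type u} [CommRing R]
    (hR : IsUMRing.{u, v} R) : IsEmpty (R →+* ZMod 2) := by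
  refine ⟨fun φ => ?_⟩
  let _ : Module R (ZMod 2) := Module.compHom (ZMod 2) φ
  let e : ULift.{v} (ZMod 2 × ZMod 2) →ₗ[R] ZMod 2 × ZMod 2 := ULift.moduleEquiv.toLinearMap
  let p := LinearMap.fst R (ZMod 2) (ZMod 2)
  let q := LinearMap.snd R (ZMod 2) (ZMod 2)
  obtain ⟨i, hi⟩ := hR (ULift.{v} (ZMod 2 × ZMod 2)) 3
    ![(p ∘ₗ e).ker, (q ∘ₗ e).ker, ((p + q) ∘ₗ e).ker] fun ⟨m⟩ => by
      have key : ∀ m : ZMod 2 × ZMod 2, m.1 = 0 ∨ m.2 = 0 ∨ m.1 + m.2 = 0 := by decide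
      rcases key m with hm | hm | hm
      exacts [⟨0, hm⟩, ⟨1, hm⟩, ⟨2, hm⟩]
  have h10 : (1 : ZMod 2) ≠ 0 := by decide
  fin_cases i
  · exact h10 (hi ⟨(1, 0)⟩)
  · exact h10 (hi ⟨(0, 1)⟩)
  · exact h10 ((add_zero 1).symm.trans (hi ⟨(1, 0)⟩))

/-- Over a um-ring `R`, a proper submodule `N` of `M` is classical 2-absorbing iff for
every submodule `L` of `M` not contained in `N`, the ideal `(N :_R L)` is a 2-absorbing
ideal of `R`. -/
theorem isClassical2Absorbing_iff_colon_is2Absorbing {R M : Type*} [CommRing R]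
    [Nontrivial R] [AddCommGroup M] [Module R M] (hR : IsUMRing R) (N : Submodule R M)
    (hN : N ≠ ⊤) :
    IsClassical2Absorbing N ↔ ∀ L : Submodule R M, ¬ L ≤ N → Is2AbsorbingIdeal (N.colon L) := by
  constructor
  · rintro ⟨-, h⟩ L hL
    refine ⟨fun htop => hL fun m hm => ?_, fun a b c habc => ?_⟩
    · have h1 : (1 : R) ∈ N.colon (L : Set M) := htop ▸ Submodule.mem_top
      simpa using Submodule.mem_colon.1 h1 m hm
    · have mem_colon_of_eq_top : ∀ r : R,
          N.comap (LinearMap.lsmul R M r ∘ₗ L.subtype) = ⊤ → r ∈ N.colon (L : Set M) :=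
        fun r hr => Submodule.mem_colon.2 fun m hm =>
          (Submodule.eq_top_iff'.1 hr ⟨m, hm⟩ :)
      exact (Submodule.eq_top_of_forall_mem_three hR.isEmpty_ringHom_zmod_two
        fun m : L => h a b c m (Submodule.mem_colon.1 habc m m.2)).imp
          (mem_colon_of_eq_top _) (Or.imp (mem_colon_of_eq_top _) (mem_colon_of_eq_top _))
  · refine fun h => ⟨hN, fun a b c m habc => ?_⟩
    by_cases hm : m ∈ N
    · exact Or.inl (N.smul_mem _ hm)
    · have := (h (Submodule.span R {m}) (by simpa using hm)).2 a b c
      simp only [Submodule.mem_colon_span_singleton] at this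
      exact this habc
end

section
/- Let M be a module over a commutative ring R and N a classical 2-absorbing submodule of M. Then for every a,b,c ∈ R and m ∈ M, (N :_R abcm) = (N :_R abm) ∪ (N :_R acm) ∪ (N :_R bcm). -/
/-- If `N` is a classical 2-absorbing submodule of `M`, then for all `a, b, c ∈ R` and
`m ∈ M`, `(N :_R abcm) = (N :_R abm) ∪ (N :_R acm) ∪ (N :_R bcm)`. -/
theorem colon_abcm_eq_union {R M : Type*} [CommRing R] [Nontrivial R]
    [AddCommGroup M] [Module R M] (N : Submodule R M) (hN : IsClassical2Absorbing N)
    (a b c : R) (m : M) :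
    {r : R | r • ((a * b * c) • m) ∈ N} =
      {r : R | r • ((a * b) • m) ∈ N} ∪ {r : R | r • ((a * c) • m) ∈ N} ∪
        {r : R | r • ((b * c) • m) ∈ N} := by
  ext r
  simp only [Set.mem_union, Set.mem_ofPred_eq, or_assoc]
  simp only [smul_comm r]
  refine ⟨hN.2 a b c (r • m), ?_⟩
  rintro (h | h | h)
  · simpa only [smul_smul, mul_comm, mul_left_comm, mul_assoc] using N.smul_mem c h
  · simpa only [smul_smul, mul_comm, mul_left_comm, mul_assoc] using N.smul_mem b h
  · simpa only [smul_smul, mul_comm, mul_left_comm, mul_assoc] using N.smul_mem a h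
end

section
/- Let R = R₁ × R₂ be a product of two commutative rings, M = M₁ × M₂ an R-module where M₁ is an R₁-module and M₂ is an R₂-module, and let N = N₁ × N₂ be a proper submodule of M with N₁ a submodule of M₁ and N₂ a submodule of M₂. Then N is a classical 2-absorbing submodule of M if and only if either N₁ = M₁ and N₂ is a classical 2-absorbing submodule of M₂, or N₂ = M₂ and N₁ is a classical 2-absorbing submodule of M₁, or N₁ and N₂ are classical prime submodules of M₁ and M₂ respectively. -/
section Prod

variable {R₁ R₂ M₁ M₂ : Type*} [CommRing R₁] [CommRing R₂]
  [AddCommGroup M₁] [AddCommGroup M₂] [Module R₁ M₁] [Module R₂ M₂]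

/-- The componentwise action makes `M₁ × M₂` a module over `R₁ × R₂`. -/
instance Prod.moduleProd : Module (R₁ × R₂) (M₁ × M₂) where
  smul r m := (r.1 • m.1, r.2 • m.2)
  one_smul m := Prod.ext (one_smul _ _) (one_smul _ _)
  mul_smul r s m := Prod.ext (mul_smul _ _ _) (mul_smul _ _ _)
  smul_zero r := Prod.ext (smul_zero _) (smul_zero _)
  smul_add r m n := Prod.ext (smul_add _ _ _) (smul_add _ _ _)
  add_smul r s m := Prod.ext (add_smul _ _ _) (add_smul _ _ _)
  zero_smul m := Prod.ext (zero_smul _ _) (zero_smul _ _)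

/-- The submodule `N₁ × N₂` of the `(R₁ × R₂)`-module `M₁ × M₂`. -/
def Submodule.prodProd (N₁ : Submodule R₁ M₁) (N₂ : Submodule R₂ M₂) :
    Submodule (R₁ × R₂) (M₁ × M₂) where
  carrier := (N₁ : Set M₁) ×ˢ (N₂ : Set M₂)
  zero_mem' := ⟨N₁.zero_mem, N₂.zero_mem⟩
  add_mem' := fun ha hb => ⟨N₁.add_mem ha.1 hb.1, N₂.add_mem ha.2 hb.2⟩
  smul_mem' := fun r x hx => ⟨N₁.smul_mem r.1 hx.1, N₂.smul_mem r.2 hx.2⟩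

theorem Submodule.mul_smul_mem_of_right (N : Submodule R₁ M₁) {r s : R₁} {m : M₁}
    (h : s • m ∈ N) : (r * s) • m ∈ N := by
  rw [mul_smul]
  exact N.smul_mem r h

theorem Submodule.mul_smul_mem_of_left (N : Submodule R₁ M₁) {r s : R₁} {m : M₁}
    (h : r • m ∈ N) : (r * s) • m ∈ N := by
  rw [mul_comm]
  exact N.mul_smul_mem_of_right h

@[simp]
theorem Submodule.mk_mem_prodProd {N₁ : Submodule R₁ M₁} {N₂ : Submodule R₂ M₂}
    {x : M₁} {y : M₂} : (x, y) ∈ N₁.prodProd N₂ ↔ x ∈ N₁ ∧ y ∈ N₂ :=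
  Iff.rfl

@[simp]
theorem Prod.mk_smul_mk_componentwise (a : R₁) (b : R₂) (x : M₁) (y : M₂) :
    (a, b) • (x, y) = (a • x, b • y) :=
  rfl

theorem Submodule.prodProd_eq_top {N₁ : Submodule R₁ M₁} {N₂ : Submodule R₂ M₂} :
    N₁.prodProd N₂ = ⊤ ↔ N₁ = ⊤ ∧ N₂ = ⊤ := by
  simp only [Submodule.eq_top_iff', Prod.forall, mk_mem_prodProd]
  exact ⟨fun h => ⟨fun x => (h x 0).1, fun y => (h 0 y).2⟩, fun h x y => ⟨h.1 x, h.2 y⟩⟩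

theorem IsClassicalPrime.smul_mem_of_mul_mul_smul_mem {N : Submodule R₁ M₁}
    (hN : IsClassicalPrime N) {a b c : R₁} {m : M₁} (h : (a * b * c) • m ∈ N) :
    a • m ∈ N ∨ b • m ∈ N ∨ c • m ∈ N := by
  rcases hN.2 _ _ _ h with h | h
  · exact (hN.2 _ _ _ h).imp_right Or.inl
  · exact Or.inr (Or.inr h)

theorem isClassical2Absorbing_top_prodProd_iff {N₂ : Submodule R₂ M₂} :
    IsClassical2Absorbing ((⊤ : Submodule R₁ M₁).prodProd N₂) ↔ IsClassical2Absorbing N₂ := by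
  simp only [IsClassical2Absorbing, ne_eq, Submodule.prodProd_eq_top, true_and, Prod.forall,
    Prod.mk_mul_mk, Prod.mk_smul_mk_componentwise, Submodule.mk_mem_prodProd, Submodule.mem_top]
  exact and_congr_right fun _ =>
    ⟨fun h a b c m => h 0 a 0 b 0 c 0 m, fun h _ a _ b _ c _ m => h a b c m⟩

theorem isClassical2Absorbing_prodProd_top_iff {N₁ : Submodule R₁ M₁} :
    IsClassical2Absorbing (N₁.prodProd (⊤ : Submodule R₂ M₂)) ↔ IsClassical2Absorbing N₁ := by
  simp only [IsClassical2Absorbing, ne_eq, Submodule.prodProd_eq_top, and_true, Prod.forall,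
    Prod.mk_mul_mk, Prod.mk_smul_mk_componentwise, Submodule.mk_mem_prodProd, Submodule.mem_top]
  exact and_congr_right fun _ =>
    ⟨fun h a b c m => h a 0 b 0 c 0 m 0, fun h a _ b _ c _ m _ => h a b c m⟩

theorem IsClassical2Absorbing.isClassicalPrime_fst {N₁ : Submodule R₁ M₁} {N₂ : Submodule R₂ M₂}
    (h : IsClassical2Absorbing (N₁.prodProd N₂)) (h₁ : N₁ ≠ ⊤) (h₂ : N₂ ≠ ⊤) :
    IsClassicalPrime N₁ := by
  obtain ⟨y, -, hy⟩ := SetLike.exists_of_lt h₂.lt_top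
  refine ⟨h₁, fun a b m hm => ?_⟩
  simpa [hy] using h.2 (a, 1) (b, 1) (1, 0) (m, y) (by simpa using hm)

theorem IsClassical2Absorbing.isClassicalPrime_snd {N₁ : Submodule R₁ M₁} {N₂ : Submodule R₂ M₂}
    (h : IsClassical2Absorbing (N₁.prodProd N₂)) (h₁ : N₁ ≠ ⊤) (h₂ : N₂ ≠ ⊤) :
    IsClassicalPrime N₂ := by
  obtain ⟨x, -, hx⟩ := SetLike.exists_of_lt h₁.lt_top
  refine ⟨h₂, fun a b m hm => ?_⟩
  simpa [hx] using h.2 (1, a) (1, b) (0, 1) (x, m) (by simpa using hm)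

theorem IsClassicalPrime.isClassical2Absorbing_prodProd {N₁ : Submodule R₁ M₁}
    {N₂ : Submodule R₂ M₂} (h₁ : IsClassicalPrime N₁) (h₂ : IsClassicalPrime N₂) :
    IsClassical2Absorbing (N₁.prodProd N₂) := by
  refine ⟨fun h => h₁.1 (Submodule.prodProd_eq_top.1 h).1, ?_⟩
  rintro ⟨a₁, a₂⟩ ⟨b₁, b₂⟩ ⟨c₁, c₂⟩ ⟨x, y⟩ ⟨hx, hy⟩
  have hx' := h₁.smul_mem_of_mul_mul_smul_mem hx
  have hy' := h₂.smul_mem_of_mul_mul_smul_mem hy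
  simp only [Prod.mk_mul_mk, Prod.mk_smul_mk_componentwise, Submodule.mk_mem_prodProd]
  rcases hx' with hx' | hx' | hx' <;> rcases hy' with hy' | hy' | hy' <;>
    simp [N₁.mul_smul_mem_of_left, N₁.mul_smul_mem_of_right, N₂.mul_smul_mem_of_left,
      N₂.mul_smul_mem_of_right, hx', hy']

/-- For `R = R₁ × R₂` and `M = M₁ × M₂`, a proper submodule `N = N₁ × N₂` of `M` is a
classical 2-absorbing submodule of `M` iff either `N₁ = M₁` and `N₂` is a classical
2-absorbing submodule of `M₂`, or `N₂ = M₂` and `N₁` is a classical 2-absorbing submodule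
of `M₁`, or `N₁` and `N₂` are classical prime submodules of `M₁` and `M₂` respectively. -/
theorem prodProd_isClassical2Absorbing_iff [Nontrivial R₁] [Nontrivial R₂]
    (N₁ : Submodule R₁ M₁) (N₂ : Submodule R₂ M₂) (hN : N₁.prodProd N₂ ≠ ⊤) :
    IsClassical2Absorbing (N₁.prodProd N₂) ↔
      (N₁ = ⊤ ∧ IsClassical2Absorbing N₂) ∨
      (N₂ = ⊤ ∧ IsClassical2Absorbing N₁) ∨
      (IsClassicalPrime N₁ ∧ IsClassicalPrime N₂) := by
  constructor
  · intro h
    by_cases h₁ : N₁ = ⊤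
    · subst h₁
      exact Or.inl ⟨rfl, isClassical2Absorbing_top_prodProd_iff.1 h⟩
    by_cases h₂ : N₂ = ⊤
    · subst h₂
      exact Or.inr (Or.inl ⟨rfl, isClassical2Absorbing_prodProd_top_iff.1 h⟩)
    exact Or.inr (Or.inr ⟨h.isClassicalPrime_fst h₁ h₂, h.isClassicalPrime_snd h₁ h₂⟩)
  · rintro (⟨rfl, h⟩ | ⟨rfl, h⟩ | ⟨h₁, h₂⟩)
    · exact isClassical2Absorbing_top_prodProd_iff.2 h
    · exact isClassical2Absorbing_prodProd_top_iff.2 h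
    · exact h₁.isClassical2Absorbing_prodProd h₂

end Prod
end
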